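/- Let E₁, E₂ ∈ (𝓜, c_k, n_k, κ). If c_k + ξ_k ≥ 1 for every k ≥ 1, then E₁ + E₂ = {x + y : x ∈ E₁, y ∈ E₂} = [0,2] and E₁ − E₂ = {x − y : x ∈ E₁, y ∈ E₂} = [−1,1]. -/

import Mathlib

/-- The common length `c₁ ⋯ c_k` of the level-`k` basic intervals. -/
noncomputable def moranLen (c : ℕ → ℝ) (k : ℕ) : ℝ := ∏ j ∈ Finset.range k, c (j + 1)

/-- A word `w = (i₁, …, i_k)` is admissible if `i_j < n j` for all `j`. -/
def MoranAdm (n : ℕ → ℕ) (w : List ℕ) : Prop := ∀ i < w.length, w.getD i 0 < n (i + 1)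

/-- The union `C_k` of all level-`k` basic intervals, where `L w` is the left endpoint of
the basic interval coded by the word `w`. -/
def moranLevel (c : ℕ → ℝ) (n : ℕ → ℕ) (L : List ℕ → ℝ) (k : ℕ) : Set ℝ :=
  ⋃ w ∈ {w : List ℕ | MoranAdm n w ∧ w.length = k}, Set.Icc (L w) (L w + moranLen c k)

/-- `E` is a homogeneous Moran set of the class `(𝓜, c_k, n_k, κ)`, witnessed by the
left-endpoint function `L` of its basic intervals. -/
def IsMoran (c : ℕ → ℝ) (n : ℕ → ℕ) (κ : ℝ) (L : List ℕ → ℝ) (E : Set ℝ) : Prop :=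
  L [] = 0 ∧
  (∀ w : List ℕ, MoranAdm n w →
    (∀ i j : ℕ, i < j → j < n (w.length + 1) →
      L (w ++ [i]) ≤ L (w ++ [j]) ∧
      L (w ++ [i]) + moranLen c (w.length + 1) - L (w ++ [j]) ≤
        κ * moranLen c (w.length + 1)) ∧
    L (w ++ [0]) = L w ∧
    L (w ++ [n (w.length + 1) - 1]) + moranLen c (w.length + 1) =
      L w + moranLen c w.length ∧
    (⋃ i ∈ Finset.range (n (w.length + 1)),
        Set.Icc (L (w ++ [i])) (L (w ++ [i]) + moranLen c (w.length + 1)))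
      ⊂ Set.Icc (L w) (L w + moranLen c w.length)) ∧
  E = ⋂ k, moranLevel c n L k

/-- `ξ_k = c_k (2 + (n_k − 2)(1 − κ))`. -/
noncomputable def xiM (c : ℕ → ℝ) (n : ℕ → ℕ) (κ : ℝ) (k : ℕ) : ℝ :=
  c k * (2 + ((n k : ℝ) - 2) * (1 - κ))


theorem moranLen_succ' (c : ℕ → ℝ) (k : ℕ) : moranLen c (k + 1) = moranLen c k * c (k + 1) := by
  simp [moranLen, Finset.prod_range_succ]

theorem moranLen_pos' (c : ℕ → ℝ) (hc : ∀ k ≥ 1, 0 < c k ∧ c k < 1 / 2) (k : ℕ) :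
    0 < moranLen c k := by
  unfold moranLen
  exact Finset.prod_pos fun j _ => (hc (j + 1) (by omega)).1

theorem moranLen_le' (c : ℕ → ℝ) (hc : ∀ k ≥ 1, 0 < c k ∧ c k < 1 / 2) (k : ℕ) :
    moranLen c k ≤ (1 / 2) ^ k := by
  induction k with
  | zero => simp [moranLen]
  | succ k ih =>
    rw [moranLen_succ', pow_succ]
    have h := hc (k + 1) (by omega)
    have := moranLen_pos' c hc k
    exact mul_le_mul ih h.2.le h.1.le (by positivity)

theorem moranAdm_snoc (n : ℕ → ℕ) (w : List ℕ) (i : ℕ) (hw : MoranAdm n w)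
    (hi : i < n (w.length + 1)) : MoranAdm n (w ++ [i]) := by
  intro m hm
  simp only [List.length_append, List.length_singleton] at hm
  rcases Nat.lt_succ_iff_lt_or_eq.mp hm with h | h
  · rw [List.getD_append _ _ _ _ h]
    exact hw m h
  · subst h
    simpa [List.getD] using hi

theorem moran_child_le {c : ℕ → ℝ} {n : ℕ → ℕ} {κ : ℝ} {L : List ℕ → ℝ} {E : Set ℝ}
    (hE : IsMoran c n κ L E) (w : List ℕ) (hw : MoranAdm n w) (i : ℕ)
    (hi : i < n (w.length + 1)) :
    L w ≤ L (w ++ [i]) ∧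
      L (w ++ [i]) + moranLen c (w.length + 1) ≤ L w + moranLen c w.length := by
  obtain ⟨h1, h2, h3, -⟩ := hE.2.1 w hw
  constructor
  · rcases Nat.eq_zero_or_pos i with h | h
    · subst h; rw [h2]
    · rw [← h2]; exact (h1 0 i h hi).1
  · rw [← h3]
    rcases Nat.lt_or_ge i (n (w.length + 1) - 1) with h | h
    · have := (h1 i _ h (by omega)).1
      linarith
    · have : i = n (w.length + 1) - 1 := by omega
      rw [← this]

theorem moran_gap {c : ℕ → ℝ} {n : ℕ → ℕ} {κ : ℝ} {L : List ℕ → ℝ} {E : Set ℝ}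
    (hc : ∀ k ≥ 1, 0 < c k ∧ c k < 1 / 2) (hn : ∀ k ≥ 1, 2 ≤ n k)
    (h : ∀ k ≥ 1, 1 ≤ c k + xiM c n κ k)
    (hE : IsMoran c n κ L E) (w : List ℕ) (hw : MoranAdm n w) (s : ℝ)
    (hs1 : L w ≤ s) (hs2 : s ≤ L w + moranLen c w.length + moranLen c (w.length + 1)) :
    ∃ i < n (w.length + 1), L (w ++ [i]) ≤ s ∧
      s ≤ L (w ++ [i]) + 2 * moranLen c (w.length + 1) := by
  obtain ⟨h1, h2, h3, -⟩ := hE.2.1 w hw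
  have hN := hn (w.length + 1) (by omega)
  have hx := h (w.length + 1) (by omega)
  have hl := moranLen_pos' c hc w.length
  have hr := moranLen_succ' c w.length
  unfold xiM at hx
  generalize hrr : moranLen c (w.length + 1) = r at *
  generalize moranLen c w.length = l at *
  generalize c (w.length + 1) = a at *
  generalize hNN : n (w.length + 1) = N at *
  have hsep : ∀ i j, i ≤ j → j < N →
      ((j : ℝ) - i) * ((1 - κ) * r) ≤ L (w ++ [j]) - L (w ++ [i]) := by
    intro i j hij
    induction j, hij using Nat.le_induction with
    | base => intro _; simp
    | succ j hij ih =>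
      intro hj
      have e1 := ih (by omega)
      have e2 := (h1 j (j + 1) (by omega) hj).2
      push_cast
      linarith
  classical
  have hp : L (w ++ [0]) ≤ s := by rw [h2]; exact hs1
  set i := Nat.findGreatest (fun i => L (w ++ [i]) ≤ s) (N - 1) with hi
  have hi1 : i ≤ N - 1 := Nat.findGreatest_le _
  have hi2 : L (w ++ [i]) ≤ s :=
    Nat.findGreatest_spec (P := fun i => L (w ++ [i]) ≤ s) (Nat.zero_le (N - 1)) hp
  refine ⟨i, by omega, hi2, ?_⟩
  rcases Nat.lt_or_ge i (N - 1) with hlt | hge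
  · have hi3 : ¬ L (w ++ [i + 1]) ≤ s :=
      Nat.findGreatest_is_greatest (P := fun i => L (w ++ [i]) ≤ s) (Nat.lt_succ_self i) (by omega)
    have e1 := hsep 0 i (by omega) (by omega)
    have e2 := hsep (i + 1) (N - 1) (by omega) (by omega)
    have e3 : ((N - 1 : ℕ) : ℝ) = (N : ℝ) - 1 := by
      rw [Nat.cast_sub (by omega)]; simp
    rw [e3] at e2
    push_cast at e1 e2
    have e4 : l ≤ 3 * r + ((N : ℝ) - 2) * ((1 - κ) * r) := by
      have := mul_le_mul_of_nonneg_left hx hl.le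
      rw [hr]
      linarith
    push Not at hi3
    linarith
  · have : i = N - 1 := by omega
    rw [this]
    linarith

theorem moran_limit {c : ℕ → ℝ} {n : ℕ → ℕ} {κ : ℝ} {L : List ℕ → ℝ} {E : Set ℝ}
    (hc : ∀ k ≥ 1, 0 < c k ∧ c k < 1 / 2)
    (hE : IsMoran c n κ L E) (W : ℕ → List ℕ) (hlen : ∀ k, (W k).length = k)
    (hadm : ∀ k, MoranAdm n (W k)) (hstep : ∀ k, ∃ i < n (k + 1), W (k + 1) = W k ++ [i]) :
    ∃ x ∈ E, ∀ k, L (W k) ≤ x ∧ x ≤ L (W k) + moranLen c k := by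
  have hch : ∀ k, L (W k) ≤ L (W (k + 1)) ∧
      L (W (k + 1)) + moranLen c (k + 1) ≤ L (W k) + moranLen c k := by
    intro k
    obtain ⟨i, hi, e⟩ := hstep k
    have := moran_child_le hE (W k) (hadm k) i (by rw [hlen]; exact hi)
    rw [hlen] at this
    rwa [e]
  have hm : Monotone fun k => L (W k) := monotone_nat_of_le_succ fun k => (hch k).1
  have ha : Antitone fun k => L (W k) + moranLen c k := antitone_nat_of_succ_le fun k => (hch k).2
  have hx := hm.ciSup_mem_iInter_Icc_of_antitone ha
    (fun k => by have := moranLen_pos' c hc k; simp only; linarith)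
  rw [Set.mem_iInter] at hx
  refine ⟨_, ?_, hx⟩
  rw [hE.2.2, Set.mem_iInter]
  intro k
  unfold moranLevel
  simp only [Set.mem_iUnion]
  exact ⟨W k, ⟨hadm k, hlen k⟩, hx k⟩

theorem moran_pair {c : ℕ → ℝ} {n : ℕ → ℕ} {κ : ℝ} {L₁ L₂ : List ℕ → ℝ} {E₁ E₂ : Set ℝ}
    (hc : ∀ k ≥ 1, 0 < c k ∧ c k < 1 / 2)
    (hE₁ : IsMoran c n κ L₁ E₁) (hE₂ : IsMoran c n κ L₂ E₂)
    (P : List ℕ → List ℕ → Prop) (h0 : P [] [])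
    (hP : ∀ k w v, w.length = k → v.length = k → MoranAdm n w → MoranAdm n v → P w v →
      ∃ i < n (k + 1), ∃ j < n (k + 1), P (w ++ [i]) (v ++ [j])) :
    ∃ x ∈ E₁, ∃ y ∈ E₂, ∀ k, ∃ w v, w.length = k ∧ v.length = k ∧ P w v ∧
      (L₁ w ≤ x ∧ x ≤ L₁ w + moranLen c k) ∧ (L₂ v ≤ y ∧ y ≤ L₂ v + moranLen c k) := by
  let T := fun k => {p : List ℕ × List ℕ // p.1.length = k ∧ p.2.length = k ∧ MoranAdm n p.1 ∧
    MoranAdm n p.2 ∧ P p.1 p.2}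
  have hnext : ∀ k (p : T k), ∃ q : T (k + 1), (∃ i < n (k + 1), q.1.1 = p.1.1 ++ [i]) ∧
      ∃ i < n (k + 1), q.1.2 = p.1.2 ++ [i] := by
    rintro k ⟨⟨w, v⟩, hw, hv, aw, av, hp⟩
    obtain ⟨i, hi, j, hj, hq⟩ := hP k w v hw hv aw av hp
    simp only at hw hv
    exact ⟨⟨(w ++ [i], v ++ [j]), by simp [hw], by simp [hv],
      moranAdm_snoc n w i aw (by rwa [hw]), moranAdm_snoc n v j av (by rwa [hv]), hq⟩,
      ⟨i, hi, rfl⟩, ⟨j, hj, rfl⟩⟩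
  choose f hf using hnext
  let p0 : T 0 := ⟨([], []), rfl, rfl, fun i hi => by simp at hi, fun i hi => by simp at hi, h0⟩
  let W : ∀ k, T k := fun k => Nat.rec p0 (fun k p => f k p) k
  have hW : ∀ k, W (k + 1) = f k (W k) := fun k => rfl
  obtain ⟨x, hx, hxk⟩ := moran_limit hc hE₁ (fun k => (W k).1.1) (fun k => (W k).2.1)
    (fun k => (W k).2.2.2.1) (fun k => (hf k (W k)).1)
  obtain ⟨y, hy, hyk⟩ := moran_limit hc hE₂ (fun k => (W k).1.2) (fun k => (W k).2.2.1)
    (fun k => (W k).2.2.2.2.1) (fun k => (hf k (W k)).2)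
  exact ⟨x, hx, y, hy, fun k => ⟨_, _, (W k).2.1, (W k).2.2.1, (W k).2.2.2.2.2, hxk k, hyk k⟩⟩

theorem moran_sub {c : ℕ → ℝ} {n : ℕ → ℕ} {κ : ℝ} {L : List ℕ → ℝ} {E : Set ℝ}
    (hE : IsMoran c n κ L E) {x : ℝ} (hx : x ∈ E) : 0 ≤ x ∧ x ≤ 1 := by
  rw [hE.2.2, Set.mem_iInter] at hx
  have := hx 0
  unfold moranLevel at this
  simp only [Set.mem_iUnion] at this
  obtain ⟨w, ⟨-, hw⟩, h⟩ := this
  rw [List.length_eq_zero_iff.mp hw, hE.1] at h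
  simpa [moranLen] using h

theorem moran_eq_of_small {c : ℕ → ℝ} (hc : ∀ k ≥ 1, 0 < c k ∧ c k < 1 / 2) {a b : ℝ}
    (h : ∀ k, |a - b| ≤ 2 * moranLen c k) : a = b := by
  have ht : Filter.Tendsto (fun k : ℕ => 2 * (1 / 2 : ℝ) ^ k) Filter.atTop (nhds (2 * 0)) :=
    (tendsto_pow_atTop_nhds_zero_of_lt_one (by norm_num) (by norm_num)).const_mul 2
  have := ge_of_tendsto' ht (b := |a - b|) fun k =>
    (h k).trans (by have := moranLen_le' c hc k; linarith)
  have h0 : |a - b| = 0 := le_antisymm (by simpa using this) (abs_nonneg _)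
  exact sub_eq_zero.mp (abs_eq_zero.mp h0)

theorem stmt_7 (c : ℕ → ℝ) (n : ℕ → ℕ) (κ : ℝ)
    (hc : ∀ k ≥ 1, 0 < c k ∧ c k < 1 / 2) (hn : ∀ k ≥ 1, 2 ≤ n k)
    (hcn : ∀ k ≥ 1, c k * n k < 1) (hκ0 : 0 ≤ κ) (hκ1 : κ < 1)
    (L₁ L₂ : List ℕ → ℝ) (E₁ E₂ : Set ℝ)
    (hE₁ : IsMoran c n κ L₁ E₁) (hE₂ : IsMoran c n κ L₂ E₂)
    (h : ∀ k ≥ 1, 1 ≤ c k + xiM c n κ k) :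
    Set.image2 (· + ·) E₁ E₂ = Set.Icc (0 : ℝ) 2 ∧
    Set.image2 (· - ·) E₁ E₂ = Set.Icc (-1 : ℝ) 1 := by
  have key : ∀ (k : ℕ) (w v : List ℕ), w.length = k → v.length = k → MoranAdm n w →
      MoranAdm n v → (0 < moranLen c (k + 1) ∧ 2 * moranLen c (k + 1) ≤ moranLen c k) ∧
      (∀ s, L₁ w ≤ s → s ≤ L₁ w + moranLen c k + moranLen c (k + 1) →
        ∃ i < n (k + 1), L₁ (w ++ [i]) ≤ s ∧ s ≤ L₁ (w ++ [i]) + 2 * moranLen c (k + 1)) ∧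
      (0 < n (k + 1) ∧ L₂ (v ++ [0]) = L₂ v) ∧
      (n (k + 1) - 1 < n (k + 1) ∧
        L₂ (v ++ [n (k + 1) - 1]) + moranLen c (k + 1) = L₂ v + moranLen c k) := by
    intro k w v hw hv aw av
    have hN := hn (k + 1) (by omega)
    obtain ⟨-, h2, h3, -⟩ := hE₂.2.1 v av
    rw [hv] at h3
    refine ⟨⟨moranLen_pos' c hc _, ?_⟩, ?_, ⟨by omega, h2⟩, ⟨by omega, h3⟩⟩
    · rw [moranLen_succ']
      have := moranLen_pos' c hc k
      have := (hc (k + 1) (by omega)).2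
      nlinarith
    · intro s hs1 hs2
      have := moran_gap hc hn h hE₁ w aw s hs1 (by rw [hw]; exact hs2)
      rwa [hw] at this
  have hl0 : moranLen c 0 = 1 := by simp [moranLen]
  constructor
  · ext t
    constructor
    · rintro ⟨x, hx, y, hy, rfl⟩
      have := moran_sub hE₁ hx
      have := moran_sub hE₂ hy
      constructor <;> simp only <;> linarith
    · rintro ⟨ht0, ht2⟩
      obtain ⟨x, hx, y, hy, hxy⟩ := moran_pair hc hE₁ hE₂
        (fun w v => L₁ w + L₂ v ≤ t ∧ t ≤ L₁ w + L₂ v + 2 * moranLen c w.length)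
        (by simp only [hE₁.1, hE₂.1, List.length_nil, hl0]; constructor <;> linarith)
        (by
          rintro k w v hw hv aw av ⟨p1, p2⟩
          obtain ⟨⟨hr0, hr⟩, hg, ⟨q1, q2⟩, ⟨q3, q4⟩⟩ := key k w v hw hv aw av
          simp only [List.length_append, List.length_singleton, hw] at p2 ⊢
          rcases le_total (t - L₂ v) (L₁ w + moranLen c k + moranLen c (k + 1)) with hh | hh
          · obtain ⟨i, hi, e1, e2⟩ := hg (t - L₂ v) (by linarith) hh
            exact ⟨i, hi, 0, q1, by rw [q2]; constructor <;> linarith⟩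
          · obtain ⟨i, hi, e1, e2⟩ := hg (t - L₂ (v ++ [n (k + 1) - 1])) (by linarith) (by linarith)
            exact ⟨i, hi, _, q3, by constructor <;> linarith⟩)
      refine ⟨x, hx, y, hy, moran_eq_of_small hc fun k => ?_⟩
      obtain ⟨w, v, hw, hv, ⟨p1, p2⟩, ⟨x1, x2⟩, ⟨y1, y2⟩⟩ := hxy k
      rw [hw] at p2
      rw [abs_le]
      constructor <;> linarith
  · ext t
    constructor
    · rintro ⟨x, hx, y, hy, rfl⟩
      have := moran_sub hE₁ hx
      have := moran_sub hE₂ hy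
      constructor <;> simp only <;> linarith
    · rintro ⟨ht0, ht2⟩
      obtain ⟨x, hx, y, hy, hxy⟩ := moran_pair hc hE₁ hE₂
        (fun w v => L₁ w - L₂ v - moranLen c w.length ≤ t ∧
          t ≤ L₁ w - L₂ v + moranLen c w.length)
        (by simp only [hE₁.1, hE₂.1, List.length_nil, hl0]; constructor <;> linarith)
        (by
          rintro k w v hw hv aw av ⟨p1, p2⟩
          obtain ⟨⟨hr0, hr⟩, hg, ⟨q1, q2⟩, ⟨q3, q4⟩⟩ := key k w v hw hv aw av
          simp only [List.length_append, List.length_singleton, hw] at p1 p2 ⊢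
          rcases le_total (L₁ w) (t + L₂ v + moranLen c (k + 1)) with hh | hh
          · obtain ⟨i, hi, e1, e2⟩ := hg (t + L₂ v + moranLen c (k + 1)) hh (by linarith)
            exact ⟨i, hi, 0, q1, by rw [q2]; constructor <;> linarith⟩
          · obtain ⟨i, hi, e1, e2⟩ := hg (t + L₂ (v ++ [n (k + 1) - 1]) + moranLen c (k + 1))
              (by linarith) (by linarith)
            exact ⟨i, hi, _, q3, by constructor <;> linarith⟩)
      refine ⟨x, hx, y, hy, moran_eq_of_small hc fun k => ?_⟩
      obtain ⟨w, v, hw, hv, ⟨p1, p2⟩, ⟨x1, x2⟩, ⟨y1, y2⟩⟩ := hxy k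
      rw [hw] at p1 p2
      rw [abs_le]
      constructor <;> linarith
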